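/- Let T > 0 and let w: [0,T] × ℝ → ℝ be continuous, bounded, with w(t,·) continuously differentiable in x and ∂_x w continuous and bounded. Let X(t; t_o, x_o) denote the associated characteristic flow and let ρ_o ∈ L¹(ℝ; ℝ). Define the Lagrangian solution ρ(t, x) = ρ_o(X(0; t, x)) · exp(−∫_0^t ∂_x w(s, X(s; t, x)) ds). Then the L¹ norm is conserved exactly: for every t ∈ [0,T], ∫_ℝ |ρ(t, x)| dx = ∫_ℝ |ρ_o(x)| dx. -/

import Mathlib

open MeasureTheory Set
open scoped ENNReal NNReal

noncomputable def hh (w : ℝ → ℝ → ℝ) (p : ℝ × ℝ × ℝ) : ℝ :=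
  ∫ θ in (0:ℝ)..1, deriv (w p.1) (p.2.2 + θ * (p.2.1 - p.2.2))

lemma hh_cont (w : ℝ → ℝ → ℝ)
    (hwx_cont : Continuous fun p : ℝ × ℝ => deriv (w p.1) p.2) : Continuous (hh w) := by
  unfold hh
  apply intervalIntegral.continuous_parametric_intervalIntegral_of_continuous' (μ := volume)
  have : Continuous fun q : (ℝ × ℝ × ℝ) × ℝ => ((q.1.1, q.1.2.2 + q.2 * (q.1.2.1 - q.1.2.2)) : ℝ × ℝ) := by
    fun_prop
  exact hwx_cont.comp this

lemma hh_bdd (w : ℝ → ℝ → ℝ) (C : ℝ) (h : ∀ t x : ℝ, |deriv (w t) x| ≤ C) (p) : |hh w p| ≤ C := by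
  have := intervalIntegral.norm_integral_le_of_norm_le_const (a := 0) (b := 1) (C := C)
    (f := fun θ => deriv (w p.1) (p.2.2 + θ * (p.2.1 - p.2.2))) (fun x _ => h _ _)
  simpa [hh] using this

lemma hh_diag (w : ℝ → ℝ → ℝ) (s v : ℝ) : hh w (s, v, v) = deriv (w s) v := by
  simp [hh]

lemma hh_mul (w : ℝ → ℝ → ℝ) (hw_diff : ∀ t : ℝ, Differentiable ℝ (w t))
    (hwx_cont : Continuous fun p : ℝ × ℝ => deriv (w p.1) p.2) (s u v : ℝ) :
    hh w (s, u, v) * (u - v) = w s u - w s v := by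
  have hc : Continuous (deriv (w s)) := hwx_cont.comp (by fun_prop : Continuous fun x : ℝ => (s, x))
  have := intervalIntegral.integral_eq_sub_of_hasDerivAt (a := 0) (b := 1)
    (f := fun θ => w s (v + θ * (u - v)))
    (f' := fun θ => deriv (w s) (v + θ * (u - v)) * (u - v)) (by
      intro θ _
      have h1 : HasDerivAt (fun θ : ℝ => v + θ * (u - v)) (u - v) θ := by
        simpa using ((hasDerivAt_id θ).mul_const (u - v)).const_add v
      exact ((hw_diff s _).hasDerivAt).comp θ h1)
    (by apply Continuous.intervalIntegrable; fun_prop)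
  simp only [hh]
  rw [← intervalIntegral.integral_mul_const, this]
  simp

/-- clamp -/
noncomputable def cl (T s : ℝ) : ℝ := max 0 (min s T)

lemma cl_mem {T : ℝ} (hT : 0 < T) (s : ℝ) : cl T s ∈ Icc (0:ℝ) T := by
  simp [cl, hT.le]

lemma cl_eq {T s : ℝ} (hs : s ∈ Icc (0:ℝ) T) : cl T s = s := by
  simp [cl, hs.1, hs.2]

lemma cl_cont {T : ℝ} (hT : 0 < T) {f : ℝ → ℝ} (hf : ContinuousOn f (Icc 0 T)) :
    Continuous fun s => f (cl T s) :=
  hf.comp_continuous (by unfold cl; fun_prop) (cl_mem hT)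

lemma key {T : ℝ} (hT : 0 < T)
    (w : ℝ → ℝ → ℝ)
    (hw_diff : ∀ t : ℝ, Differentiable ℝ (w t))
    (hwx_cont : Continuous fun p : ℝ × ℝ => deriv (w p.1) p.2)
    {f g : ℝ → ℝ}
    (hf : ∀ t ∈ Icc (0:ℝ) T, HasDerivWithinAt f (w t (f t)) (Icc (0:ℝ) T) t)
    (hg : ∀ t ∈ Icc (0:ℝ) T, HasDerivWithinAt g (w t (g t)) (Icc (0:ℝ) T) t)
    {s t : ℝ} (hs : s ∈ Icc (0:ℝ) T) (ht : t ∈ Icc (0:ℝ) T) :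
    f s - g s = (f t - g t) *
      Real.exp (-∫ r in s..t, hh w (r, f (cl T r), g (cl T r))) := by
  have hfc := cl_cont hT (fun t ht => (hf t ht).continuousWithinAt)
  have hgc := cl_cont hT (fun t ht => (hg t ht).continuousWithinAt)
  set a : ℝ → ℝ := fun r => hh w (r, f (cl T r), g (cl T r)) with ha
  have hac : Continuous a :=
    (hh_cont w hwx_cont).comp (continuous_id.prodMk (hfc.prodMk hgc))
  set A : ℝ → ℝ := fun r => ∫ q in (0:ℝ)..r, a q with hA
  have hAd : ∀ r, HasDerivAt A (a r) r := fun r =>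
    intervalIntegral.integral_hasDerivAt_right (hac.intervalIntegrable _ _)
      (hac.stronglyMeasurableAtFilter _ _) hac.continuousAt
  set E : ℝ → ℝ := fun r => (f r - g r) * Real.exp (-A r) with hE
  have hEd : ∀ r ∈ Icc (0:ℝ) T, HasDerivWithinAt E 0 (Icc (0:ℝ) T) r := by
    intro r hr
    have h1 := ((hf r hr).sub (hg r hr)).mul ((hAd r).neg.exp.hasDerivWithinAt (s := Icc (0:ℝ) T))
    have this := hh_mul w hw_diff hwx_cont r (f r) (g r)
    have hr2 : a r = hh w (r, f r, g r) := by simp only [ha, cl_eq hr]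
    have h3 : (w r (f r) - w r (g r)) * Real.exp ((-A) r)
        + (f - g) r * (Real.exp ((-A) r) * -a r) = 0 := by
      rw [← this, hr2, Pi.sub_apply]
      ring
    rw [h3] at h1
    exact h1
  have hconst : E s = E t := by
    have := (convex_Icc (0:ℝ) T).norm_image_sub_le_of_norm_hasDerivWithin_le (C := 0) hEd
      (by simp) hs ht
    have h2 : E t - E s = 0 := by simpa using this
    linarith
  have hi : ∫ r in s..t, a r = A t - A s := by
    rw [hA]; simp only
    rw [intervalIntegral.integral_interval_sub_left (hac.intervalIntegrable _ _)
      (hac.intervalIntegrable _ _)]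
  rw [hi]
  have : -(A t - A s) = -A t + A s := by ring
  rw [this, Real.exp_add, ← mul_assoc]
  change _ = E t * _
  rw [← hconst]
  simp only [hE]
  rw [mul_assoc, ← Real.exp_add]; simp

/-- equation (4.11): conservation of the L¹ norm of Lagrangian solutions:
for the Lagrangian solution `ρ(t,x) = ρ0(X(0;t,x)) exp(-∫₀ᵗ ∂ₓw(s, X(s;t,x)) ds)` of
`∂_t ρ + ∂ₓ(ρ w) = 0`, `‖ρ(t)‖_{L¹} = ‖ρ0‖_{L¹}` for all `t ∈ [0,T]`. -/
theorem statement16 (T : ℝ) (hT : 0 < T)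
    (w : ℝ → ℝ → ℝ) (Cw : ℝ)
    (hw_cont : Continuous (Function.uncurry w))
    (hw_bdd : ∀ t x : ℝ, |w t x| ≤ Cw)
    (hw_diff : ∀ t : ℝ, Differentiable ℝ (w t))
    (hwx_cont : Continuous fun p : ℝ × ℝ => deriv (w p.1) p.2)
    (Cw' : ℝ) (hwx_bdd : ∀ t x : ℝ, |deriv (w t) x| ≤ Cw')
    (X : ℝ → ℝ → ℝ → ℝ)
    (hX0 : ∀ t0 ∈ Icc (0:ℝ) T, ∀ x0 : ℝ, X t0 t0 x0 = x0)
    (hX : ∀ t0 ∈ Icc (0:ℝ) T, ∀ x0 : ℝ, ∀ t ∈ Icc (0:ℝ) T,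
      HasDerivWithinAt (fun s => X s t0 x0) (w t (X t t0 x0)) (Icc (0:ℝ) T) t)
    (ρ0 : ℝ → ℝ) (hρ0 : Integrable ρ0 volume) :
    ∀ t ∈ Icc (0:ℝ) T,
      (∫ x : ℝ, |ρ0 (X 0 t x) * Real.exp (-∫ s in (0:ℝ)..t, deriv (w s) (X s t x))|)
        = ∫ x : ℝ, |ρ0 x| := by
  intro t ht
  have h0 : (0:ℝ) ∈ Icc (0:ℝ) T := ⟨le_rfl, hT.le⟩
  have hK := fun (x y : ℝ) {s : ℝ} (hs : s ∈ Icc (0:ℝ) T) =>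
    key hT w hw_diff hwx_cont (hX t ht y) (hX t ht x) hs ht
  have hinj : Function.Injective (X 0 t) := by
    intro x y hxy
    have := hK x y h0
    rw [hX0 t ht, hX0 t ht, hxy, sub_self] at this
    have := (mul_eq_zero.1 this.symm).resolve_right (Real.exp_pos _).ne'
    linarith
  have hsurj : Function.Surjective (X 0 t) := by
    intro z
    refine ⟨X t 0 z, ?_⟩
    have := key hT w hw_diff hwx_cont (hX t ht (X t 0 z)) (hX 0 h0 z) h0 ht
    rw [hX0 t ht, sub_self, zero_mul, hX0 0 h0] at this
    linarith
  have hXc : ∀ x, Continuous fun s => X (cl T s) t x := fun x =>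
    cl_cont hT (f := fun s => X s t x) (fun s hs => (hX t ht x s hs).continuousWithinAt)
  have hlim : ∀ x, ∀ s ∈ Icc (0:ℝ) T, Filter.Tendsto (fun y => X s t y) (nhds x) (nhds (X s t x)) := by
    intro x s hs
    rw [tendsto_iff_dist_tendsto_zero]
    have hb : ∀ y, dist (X s t y) (X s t x) ≤ dist y x * Real.exp (Cw' * |t - s|) := by
      intro y
      rw [Real.dist_eq, hK x y hs, hX0 t ht, hX0 t ht, abs_mul, Real.abs_exp, Real.dist_eq]
      gcongr
      refine (neg_le_abs _).trans ?_
      exact intervalIntegral.norm_integral_le_of_norm_le_const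
        (f := fun r => hh w (r, X (cl T r) t y, X (cl T r) t x)) (C := Cw')
        (fun r _ => hh_bdd w Cw' hwx_bdd _)
    refine squeeze_zero (fun _ => dist_nonneg) hb ?_
    have : Continuous fun y => dist y x * Real.exp (Cw' * |t - s|) := by fun_prop
    simpa using this.tendsto x
  have hder : ∀ x, HasDerivAt (X 0 t)
      (Real.exp (-∫ s in (0:ℝ)..t, deriv (w s) (X s t x))) x := by
    intro x
    rw [hasDerivAt_iff_tendsto_slope]
    have hT' : Filter.Tendsto (fun y => Real.exp
        (-∫ r in (0:ℝ)..t, hh w (r, X (cl T r) t y, X (cl T r) t x))) (nhds x)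
        (nhds (Real.exp (-∫ s in (0:ℝ)..t, deriv (w s) (X s t x)))) := by
      refine (Real.continuous_exp.tendsto _).comp (Filter.Tendsto.neg ?_)
      apply intervalIntegral.tendsto_integral_filter_of_dominated_convergence (fun _ => Cw')
      · refine Filter.Eventually.of_forall fun y => Continuous.aestronglyMeasurable ?_
        have h1 := hXc x
        have h2 := hXc y
        exact (hh_cont w hwx_cont).comp (continuous_id.prodMk (h2.prodMk h1))
      · exact Filter.Eventually.of_forall fun y => Filter.Eventually.of_forall fun r _ =>
          hh_bdd w Cw' hwx_bdd _
      · simp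
      · refine Filter.Eventually.of_forall fun r hr => ?_
        rw [uIoc_of_le ht.1] at hr
        have hr' : r ∈ Icc (0:ℝ) T := ⟨hr.1.le, hr.2.trans ht.2⟩
        rw [cl_eq hr', ← hh_diag w r (X r t x)]
        refine ((hh_cont w hwx_cont).tendsto _).comp ?_
        exact tendsto_const_nhds.prodMk_nhds ((hlim x r hr').prodMk_nhds tendsto_const_nhds)
    refine (hT'.mono_left nhdsWithin_le_nhds).congr' ?_
    filter_upwards [self_mem_nhdsWithin] with y hy
    have hne : y - x ≠ 0 := sub_ne_zero.2 hy
    rw [slope_def_field, hK x y h0, hX0 t ht, hX0 t ht]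
    field_simp
  have := integral_image_eq_integral_abs_deriv_smul (s := univ) (f := X 0 t)
    MeasurableSet.univ (fun x _ => (hder x).hasDerivWithinAt) hinj.injOn (fun x => |ρ0 x|)
  rw [image_univ, hsurj.range_eq, setIntegral_univ, setIntegral_univ] at this
  rw [this]
  congr 1
  ext x
  rw [abs_mul, smul_eq_mul, mul_comm]
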